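/- Let X ⊂ ℙ⁵(ℂ) be a smooth hypersurface of degree d ≥ 3 defined by F₁(x₀,x₁,x₂) = F₂(y₀,y₁,y₂) with F₁ not equivalent to F₂ under GL₃(ℂ). Then the number of planes contained in X is exactly d·ν₁·ν₂, where νᵢ is the number of d-flex points of the curve Fᵢ = 0. -/

import Mathlib

open MvPolynomial

noncomputable section

/-- `F(g·x)`: the substitution of a linear change of variables `g` into `F`. -/
def applyMat (g : Matrix (Fin 3) (Fin 3) ℂ) (F : MvPolynomial (Fin 3) ℂ) :
    MvPolynomial (Fin 3) ℂ :=
  aeval (fun i => ∑ j, C (g i j) * X j) F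

/-- The polynomial `F₁(x₀,x₁,x₂) - F₂(y₀,y₁,y₂)` defining the hypersurface `X ⊂ ℙ⁵`. -/
def hyperPoly (F₁ F₂ : MvPolynomial (Fin 3) ℂ) : MvPolynomial (Fin 6) ℂ :=
  rename (![0, 1, 2] : Fin 3 → Fin 6) F₁ - rename (![3, 4, 5] : Fin 3 → Fin 6) F₂

/-- A nonzero vector `p` represents a `d`-flex point of the plane curve `F = 0`:
`p` is on the curve and there is a line through `p` (spanned by `p` and `q`) meeting the
curve with intersection multiplicity `d` at `p`, i.e. `F(s·p + t·q) = c·t^d`. -/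
def IsDFlexRep (d : ℕ) (F : MvPolynomial (Fin 3) ℂ) (p : Fin 3 → ℂ) : Prop :=
  eval p F = 0 ∧
    ∃ q : Fin 3 → ℂ, LinearIndependent ℂ ![p, q] ∧ ∃ c : ℂ, c ≠ 0 ∧
      aeval (fun i => C (p i) * X 0 + C (q i) * X 1) F
        = (C c * X 1 ^ d : MvPolynomial (Fin 2) ℂ)

/-- The number of `d`-flex points of the plane curve `F = 0`, as points of `ℙ²(ℂ)`. -/
def flexCount (d : ℕ) (F : MvPolynomial (Fin 3) ℂ) : ℕ :=
  {x : Projectivization ℂ (Fin 3 → ℂ) | IsDFlexRep d F x.rep}.ncard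

/-- The set of planes (2-dimensional linear subspaces of `ℙ⁵`, i.e. 3-dimensional linear
subspaces of `ℂ⁶`) contained in the hypersurface `P = 0`. -/
def planesIn (P : MvPolynomial (Fin 6) ℂ) : Set (Submodule ℂ (Fin 6 → ℂ)) :=
  {W | Module.finrank ℂ W = 3 ∧ ∀ v ∈ W, eval v P = 0}

/-! ### Auxiliary lemmas -/

abbrev V3 := Fin 3 → ℂ

theorem eval_smul_hom {σ : Type*} [Fintype σ] {n : ℕ} {F : MvPolynomial σ ℂ}
    (h : F.IsHomogeneous n) (r : ℂ) (x : σ → ℂ) : eval (r • x) F = r ^ n * eval x F := by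
  rw [eval_eq', eval_eq', Finset.mul_sum]
  refine Finset.sum_congr rfl fun m hm => ?_
  have h1 : ∑ i, m i = n := by
    have := h (mem_support_iff.mp hm)
    rw [← this, Finsupp.weight_apply, Finsupp.sum_fintype _ _ (by simp)]
    simp
  simp only [Pi.smul_apply, smul_eq_mul, mul_pow, Finset.prod_mul_distrib,
    Finset.prod_pow_eq_pow_sum, h1]
  ring

/-- the gradient as a linear form -/
def gradF {σ : Type*} [Fintype σ] (F : MvPolynomial σ ℂ) (v : σ → ℂ) : (σ → ℂ) →ₗ[ℂ] ℂ :=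
  ∑ i, (eval v (pderiv i F)) • LinearMap.proj i

theorem gradF_apply {σ : Type*} [Fintype σ] (F : MvPolynomial σ ℂ) (v a : σ → ℂ) :
    gradF F v a = ∑ i, eval v (pderiv i F) * a i := by
  simp [gradF]

theorem hasDerivAt_line {σ : Type*} [Fintype σ] (F : MvPolynomial σ ℂ) (v a : σ → ℂ) :
    HasDerivAt (fun t : ℂ => eval (v + t • a) F) (gradF F v a) 0 := by
  classical
  rw [gradF_apply]
  induction F using MvPolynomial.induction_on with
  | C c => simpa using hasDerivAt_const (0 : ℂ) c
  | add p q hp hq =>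
    have := hp.add hq
    simp only [map_add, add_mul, Finset.sum_add_distrib]
    exact this
  | mul_X p j hp =>
    have h2 : HasDerivAt (fun t : ℂ => v j + t * a j) (a j) 0 := by
      simpa using ((hasDerivAt_id (0 : ℂ)).mul_const (a j)).const_add (v j)
    have := hp.mul h2
    simp only [map_mul, eval_X, Pi.add_apply, Pi.smul_apply, smul_eq_mul]
    refine HasDerivAt.congr_deriv this (Eq.symm ?_)
    simp only [Derivation.leibniz, pderiv_X, smul_eq_mul, map_add, map_mul, eval_X, add_mul,
      Finset.sum_add_distrib, zero_smul, add_zero, zero_mul]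
    rw [add_comm, Finset.sum_mul]
    congr 1
    · exact Finset.sum_congr rfl fun i _ => by ring
    · rw [Finset.sum_eq_single j]
      · simp
      · intro b _ hb
        simp [Pi.single_apply, hb]
        try tauto
      · simp

def SmoothF (F : MvPolynomial (Fin 3) ℂ) : Prop := ∀ v : V3, v ≠ 0 → gradF F v ≠ 0

theorem gradF_eq_zero_iff {σ : Type*} [Fintype σ] (F : MvPolynomial σ ℂ) (v : σ → ℂ) :
    gradF F v = 0 ↔ ∀ i, eval v (pderiv i F) = 0 := by
  classical
  constructor
  · intro h i
    have := congrArg (fun f => f (Pi.single i 1)) h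
    simpa [gradF_apply, Pi.single_apply] using this
  · intro h
    ext i
    simp [gradF, h]

theorem gradF_zero {σ : Type*} [Fintype σ] {F : MvPolynomial σ ℂ} {d : ℕ} (hd : 2 ≤ d)
    (h : F.IsHomogeneous d) : gradF F 0 = 0 := by
  rw [gradF_eq_zero_iff]
  intro i
  have := eval_smul_hom (h.pderiv (i := i)) 0 0
  rw [zero_pow (by omega)] at this
  simpa using this

theorem euler_zero {σ : Type*} [Fintype σ] {F : MvPolynomial σ ℂ} {d : ℕ} (hd : 2 ≤ d)
    (h : F.IsHomogeneous d) (v : σ → ℂ) (hv : gradF F v = 0) : eval v F = 0 := by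
  rw [gradF_eq_zero_iff] at hv
  have := congrArg (eval v) h.sum_X_mul_pderiv
  simp [hv] at this
  rcases this with h | h
  · omega
  · exact h

theorem grad_of_pow {σ : Type*} [Fintype σ] {F : MvPolynomial σ ℂ} {d : ℕ} (hd : 2 ≤ d)
    (p a : σ → ℂ) (c : ℂ) (h : ∀ t : ℂ, eval (p + t • a) F = c * t ^ d) : gradF F p a = 0 := by
  have h1 := hasDerivAt_line F p a
  simp only [h] at h1
  have h2 := (hasDerivAt_pow d (0 : ℂ)).const_mul c
  rw [zero_pow (by omega)] at h2
  simpa using h1.unique h2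

theorem grad_of_const {σ : Type*} [Fintype σ] {F : MvPolynomial σ ℂ}
    (p a : σ → ℂ) (c : ℂ) (h : ∀ t : ℂ, eval (p + t • a) F = c) : gradF F p a = 0 := by
  have h1 := hasDerivAt_line F p a
  simp only [h] at h1
  exact h1.unique (hasDerivAt_const 0 c)

theorem finrank_pair {p a : V3} (h : LinearIndependent ℂ ![p, a]) :
    Module.finrank ℂ (Submodule.span ℂ {p, a}) = 2 := by
  have := finrank_span_eq_card h
  rw [Matrix.range_cons_cons_empty] at this
  simpa using this

theorem form_zero {p a w : V3} (h : LinearIndependent ℂ ![p, a])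
    (hw : w ∉ Submodule.span ℂ {p, a}) (φ : V3 →ₗ[ℂ] ℂ) (h1 : φ p = 0) (h2 : φ a = 0)
    (h3 : φ w = 0) : φ = 0 := by
  have hle : Submodule.span ℂ {p, a} ≤ LinearMap.ker φ := by
    rw [Submodule.span_le]
    rintro x (rfl | rfl) <;> simpa
  have hlt : Submodule.span ℂ {p, a} < LinearMap.ker φ :=
    lt_of_le_of_ne hle fun e => hw (by rw [e]; simpa using h3)
  have h4 := Submodule.finrank_lt_finrank_of_lt hlt
  rw [finrank_pair h] at h4
  have h5 : Module.finrank ℂ (LinearMap.ker φ) ≤ Module.finrank ℂ V3 := Submodule.finrank_le _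
  have h6 : Module.finrank ℂ V3 = 3 := by simp
  exact LinearMap.ker_eq_top.mp (Submodule.eq_top_of_finrank_eq (by omega))

theorem binary_zero {n : ℕ} (hn : 1 ≤ n) {H : MvPolynomial (Fin 3) ℂ} (hH : H.IsHomogeneous n)
    {p a : V3} (h : LinearIndependent ℂ ![p, a]) :
    ∃ s t : ℂ, s • p + t • a ≠ 0 ∧ eval (s • p + t • a) H = 0 := by
  rw [LinearIndependent.pair_iff] at h
  by_contra! hcon
  have key : ∀ s t : ℂ, (s ≠ 0 ∨ t ≠ 0) → eval (s • p + t • a) H ≠ 0 := by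
    intro s t hst
    apply hcon
    intro h0
    have := h s t h0
    tauto
  let g : Polynomial ℂ := aeval (fun i => Polynomial.C (p i) + Polynomial.X * Polynomial.C (a i)) H
  have hg : ∀ t, g.eval t = eval (p + t • a) H := by
    intro t
    have : (Polynomial.evalRingHom t) g = _ := map_aeval (fun i => Polynomial.C (p i) + Polynomial.X * Polynomial.C (a i)) (Polynomial.evalRingHom t) H
    rw [Polynomial.coe_evalRingHom] at this
    rw [this, coe_eval₂Hom, eval₂_eq', eval_eq']
    simp [mul_comm t]
  have hdeg : g.degree = 0 := by
    by_contra hne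
    obtain ⟨t, ht⟩ := IsAlgClosed.exists_root g hne
    apply key 1 t (by simp)
    rw [Polynomial.IsRoot, hg] at ht
    simpa using ht
  obtain ⟨c, hc⟩ : ∃ c, g = Polynomial.C c := ⟨_, Polynomial.eq_C_of_degree_eq_zero hdeg⟩
  have hg' : ∀ t : ℂ, eval (p + t • a) H = c := by
    intro t
    rw [← hg, hc, Polynomial.eval_C]
  have h1 : ∀ s : ℂ, s ≠ 0 → eval (a + s • p) H = c * s ^ n := by
    intro s hs
    have := eval_smul_hom hH s (p + s⁻¹ • a)
    rw [hg', smul_add, smul_smul, mul_inv_cancel₀ hs, one_smul, add_comm] at this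
    rw [this, mul_comm]
  have hcont : Continuous (fun s : ℂ => eval (a + s • p) H) :=
    (MvPolynomial.continuous_eval H).comp (by fun_prop)
  have hcont2 : Continuous (fun s : ℂ => c * s ^ n) := by fun_prop
  have heq := Continuous.ext_on (dense_compl_singleton (0 : ℂ)) hcont hcont2
    (fun s hs => h1 s hs)
  have := congrFun heq 0
  simp only [zero_smul, add_zero, zero_pow (show n ≠ 0 by omega), mul_zero] at this
  exact key 0 1 (by simp) (by simpa using this)

theorem no_line {d : ℕ} (hd : 2 ≤ d) {F : MvPolynomial (Fin 3) ℂ} (hF : F.IsHomogeneous d)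
    (hs : SmoothF F) {p a : V3} (h : LinearIndependent ℂ ![p, a]) :
    ¬ ∀ s t : ℂ, eval (s • p + t • a) F = 0 := by
  intro h0
  obtain ⟨w, hw⟩ : ∃ w, w ∉ Submodule.span ℂ {p, a} := by
    by_contra! hcon
    have h1 : Submodule.span ℂ {p, a} = ⊤ := Submodule.eq_top_iff'.mpr hcon
    have h2 := finrank_pair h
    rw [h1] at h2
    simp at h2
  let H : MvPolynomial (Fin 3) ℂ := ∑ i, pderiv i F * C (w i)
  have hH : H.IsHomogeneous (d - 1) := by
    apply IsHomogeneous.sum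
    intro i _
    simpa using hF.pderiv.mul (isHomogeneous_C (Fin 3) (w i))
  obtain ⟨s, t, hne, hz⟩ := binary_zero (by omega) hH h
  apply hs _ hne
  apply form_zero h hw
  · apply grad_of_const _ _ 0
    intro r
    rw [← h0 (s + r) t]
    congr 2
    module
  · apply grad_of_const _ _ 0
    intro r
    rw [← h0 s (t + r)]
    congr 2
    module
  · rw [gradF_apply]
    simpa [H] using hz

/-- normalised flex data -/
def FlexDat (d : ℕ) (F : MvPolynomial (Fin 3) ℂ) (p a : V3) (c : ℂ) : Prop :=
  LinearIndependent ℂ ![p, a] ∧ ∀ s t : ℂ, eval (s • p + t • a) F = c * t ^ d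

theorem isDFlexRep_iff {d : ℕ} (hd : 2 ≤ d) (F : MvPolynomial (Fin 3) ℂ) (p : V3) :
    IsDFlexRep d F p ↔ ∃ a c, c ≠ 0 ∧ FlexDat d F p a c := by
  have hev : ∀ (a : V3) (x : Fin 2 → ℂ), eval x (aeval (fun i => C (p i) * X 0 + C (a i) * X 1) F :
      MvPolynomial (Fin 2) ℂ) = eval (x 0 • p + x 1 • a) F := by
    intro a x
    have := map_aeval (fun i => (C (p i) * X 0 + C (a i) * X 1 : MvPolynomial (Fin 2) ℂ)) (eval x) F
    rw [this, coe_eval₂Hom, eval₂_eq', eval_eq']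
    simp [mul_comm]
  constructor
  · rintro ⟨_, a, hli, c, hc, h⟩
    refine ⟨a, c, hc, hli, fun s t => ?_⟩
    have := hev a ![s, t]
    rw [h] at this
    simpa using this.symm
  · rintro ⟨a, c, hc, hli, h⟩
    refine ⟨?_, a, hli, c, hc, ?_⟩
    · have := h 1 0
      rw [zero_pow (by omega)] at this
      simpa using this
    · apply MvPolynomial.funext
      intro x
      rw [hev, h]
      simp

theorem exists_norm {d : ℕ} (hd : 2 ≤ d) (F : MvPolynomial (Fin 3) ℂ) (p : V3)
    (h : IsDFlexRep d F p) : ∃ a, FlexDat d F p a 1 := by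
  obtain ⟨a, c, hc, hli, h⟩ := (isDFlexRep_iff hd F p).mp h
  obtain ⟨r, hr⟩ := IsAlgClosed.exists_pow_nat_eq c⁻¹ (show 0 < d by omega)
  have hr0 : r ≠ 0 := by
    rintro rfl
    rw [zero_pow (by omega)] at hr
    exact hc (by simpa using hr.symm)
  refine ⟨r • a, ?_, fun s t => ?_⟩
  · rw [LinearIndependent.pair_iff] at hli ⊢
    intro s t hst
    rw [smul_smul] at hst
    have := hli _ _ hst
    simpa [hr0] using this
  · rw [smul_smul, h, mul_pow, hr]
    field_simp

theorem tangent_unique {d : ℕ} (hd : 2 ≤ d) {F : MvPolynomial (Fin 3) ℂ} (hs : SmoothF F)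
    {p a b : V3} {c c' : ℂ} (h : FlexDat d F p a c) (h' : FlexDat d F p b c') :
    ∃ α β : ℂ, β ≠ 0 ∧ b = α • p + β • a := by
  have hp : p ≠ 0 := h.1.ne_zero 0
  have hb : b ∈ Submodule.span ℂ {p, a} := by
    by_contra hb
    apply hs p hp
    apply form_zero h.1 hb
    · apply grad_of_const _ _ 0
      intro t
      have := h.2 (1 + t) 0
      rw [zero_pow (by omega)] at this
      rw [← mul_zero c, ← this]
      congr 2
      module
    · apply grad_of_pow hd _ _ c
      intro t
      rw [← h.2 1 t, one_smul]
    · apply grad_of_pow hd _ _ c'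
      intro t
      rw [← h'.2 1 t, one_smul]
  obtain ⟨α, β, hab⟩ := Submodule.mem_span_pair.mp hb
  refine ⟨α, β, ?_, hab.symm⟩
  rintro rfl
  have := (LinearIndependent.pair_iff.mp h'.1) α (-1) (by rw [← hab]; module)
  simp at this

/-- the planes, in product form -/
def planesP (F₁ F₂ : MvPolynomial (Fin 3) ℂ) : Set (Submodule ℂ (V3 × V3)) :=
  {W | Module.finrank ℂ W = 3 ∧ ∀ v ∈ W, eval v.1 F₁ = eval v.2 F₂}

theorem graph_case {d : ℕ} (hd : 2 ≤ d) {F₁ F₂ : MvPolynomial (Fin 3) ℂ}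
    (hF₁ : F₁.IsHomogeneous d) (hF₂ : F₂.IsHomogeneous d)
    (hs : SmoothF F₁) {W : Submodule ℂ (V3 × V3)} (hW : W ∈ planesP F₁ F₂)
    (hU : ∀ y, ((0 : V3), y) ∈ W → y = 0) :
    ∃ A : V3 ≃ₗ[ℂ] V3, ∀ x, eval x F₁ = eval (A x) F₂ := by
  let f : W →ₗ[ℂ] V3 := (LinearMap.fst ℂ V3 V3).comp W.subtype
  have hf : Function.Injective f := by
    rw [← LinearMap.ker_eq_bot, LinearMap.ker_eq_bot']
    rintro ⟨⟨x, y⟩, hxy⟩ h0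
    have hx : x = 0 := h0
    subst hx
    have := hU y hxy
    subst this
    rfl
  have hfr : Module.finrank ℂ W = Module.finrank ℂ V3 := by rw [hW.1]; simp
  let e := LinearMap.linearEquivOfInjective f hf hfr
  let B : V3 →ₗ[ℂ] V3 := ((LinearMap.snd ℂ V3 V3).comp W.subtype).comp e.symm.toLinearMap
  have hB : ∀ x, eval x F₁ = eval (B x) F₂ := by
    intro x
    have h1 := hW.2 _ (e.symm x).2
    have h2 : ((e.symm x : W) : V3 × V3).1 = x := e.apply_symm_apply x
    rw [h2] at h1
    exact h1
  have hBi : Function.Injective B := by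
    rw [← LinearMap.ker_eq_bot, LinearMap.ker_eq_bot']
    intro k hk
    by_contra hk0
    apply hs k hk0
    apply LinearMap.ext
    intro r
    apply grad_of_pow hd _ _ (eval r F₁)
    intro t
    rw [hB, map_add, hk, zero_add, map_smul, eval_smul_hom hF₂, ← hB, mul_comm]
  exact ⟨LinearMap.linearEquivOfInjective B hBi rfl, hB⟩

theorem equiv_of_eval {F₁ F₂ : MvPolynomial (Fin 3) ℂ} (A : V3 ≃ₗ[ℂ] V3)
    (h : ∀ x, eval x F₂ = eval (A x) F₁) :
    ∃ g : Matrix (Fin 3) (Fin 3) ℂ, IsUnit g.det ∧ applyMat g F₁ = F₂ := by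
  refine ⟨LinearMap.toMatrix' A.toLinearMap, ?_, ?_⟩
  · rw [LinearMap.det_toMatrix']
    exact LinearEquiv.isUnit_det' A
  · apply MvPolynomial.funext
    intro x
    rw [h, applyMat]
    have := map_aeval (fun i => ∑ j, C (LinearMap.toMatrix' A.toLinearMap i j) * X j :
      Fin 3 → MvPolynomial (Fin 3) ℂ) (eval x) F₁
    rw [this, coe_eval₂Hom, eval₂_eq', eval_eq']
    have hA : A x = (LinearMap.toMatrix' A.toLinearMap).mulVec x := by
      rw [LinearMap.toMatrix'_mulVec]; rfl
    simp [hA, Matrix.mulVec, dotProduct]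

theorem planesP_swap {F₁ F₂ : MvPolynomial (Fin 3) ℂ} {W : Submodule ℂ (V3 × V3)}
    (hW : W ∈ planesP F₁ F₂) :
    W.map (LinearEquiv.prodComm ℂ V3 V3).toLinearMap ∈ planesP F₂ F₁ := by
  refine ⟨?_, ?_⟩
  · rw [LinearEquiv.finrank_map_eq]; exact hW.1
  · rintro _ ⟨⟨x, y⟩, hxy, rfl⟩
    exact (hW.2 _ hxy).symm

/-- the plane attached to flex data -/
def mkPlane (p a q b : V3) : Submodule ℂ (V3 × V3) :=
  Submodule.span ℂ (Set.range ![((p, 0) : V3 × V3), (0, q), (a, b)])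

theorem mem_mkPlane {p a q b : V3} {v : V3 × V3} :
    v ∈ mkPlane p a q b ↔ ∃ s r t : ℂ, v = (s • p + t • a, r • q + t • b) := by
  rw [mkPlane, Submodule.mem_span_range_iff_exists_fun]
  constructor
  · rintro ⟨c, rfl⟩
    refine ⟨c 0, c 1, c 2, ?_⟩
    simp [Fin.sum_univ_three]
  · rintro ⟨s, r, t, rfl⟩
    refine ⟨![s, r, t], ?_⟩
    simp [Fin.sum_univ_three]

theorem finrank_mkPlane {p a q b : V3} (h : LinearIndependent ℂ ![p, a]) (hq : q ≠ 0) :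
    Module.finrank ℂ (mkPlane p a q b) = 3 := by
  have : LinearIndependent ℂ ![((p, 0) : V3 × V3), (0, q), (a, b)] := by
    rw [Fintype.linearIndependent_iff]
    intro c hc
    simp [Fin.sum_univ_three] at hc
    obtain ⟨h1, h2⟩ := hc
    obtain ⟨h3, h4⟩ := LinearIndependent.pair_iff.mp h _ _ h1
    rw [h4] at h2
    simp [hq] at h2
    intro i
    fin_cases i <;> simp [h3, h4, h2]
  have h2 := finrank_span_eq_card this
  rw [Fintype.card_fin] at h2
  exact h2

theorem plane_struct {d : ℕ} (hd : 2 ≤ d) {F₁ F₂ : MvPolynomial (Fin 3) ℂ}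
    (hF₁ : F₁.IsHomogeneous d) (hF₂ : F₂.IsHomogeneous d) (hs₁ : SmoothF F₁) (hs₂ : SmoothF F₂)
    {W : Submodule ℂ (V3 × V3)} (hW : W ∈ planesP F₁ F₂) {p q : V3} (hp : p ≠ 0) (hq : q ≠ 0)
    (hpW : (p, (0 : V3)) ∈ W) (hqW : ((0 : V3), q) ∈ W) :
    ∃ a b c, c ≠ 0 ∧ (a, b) ∈ W ∧ FlexDat d F₁ p a c ∧ FlexDat d F₂ q b c := by
  have z1 : eval (0 : V3) F₁ = 0 := euler_zero hd hF₁ 0 (gradF_zero hd hF₁)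
  have z2 : eval (0 : V3) F₂ = 0 := euler_zero hd hF₂ 0 (gradF_zero hd hF₂)
  have hT : ∀ x : V3, (x, (0 : V3)) ∈ W → ∃ k : ℂ, k • p = x := by
    intro x hx
    by_contra! hcon
    apply no_line hd hF₁ hs₁ ((LinearIndependent.pair_iff' hp).mpr hcon)
    intro s t
    have := hW.2 _ (W.add_mem (W.smul_mem s hpW) (W.smul_mem t hx))
    simp only [Prod.smul_mk, Prod.mk_add_mk, smul_zero, add_zero, z2] at this
    exact this
  have hU : ∀ y : V3, ((0 : V3), y) ∈ W → ∃ k : ℂ, k • q = y := by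
    intro x hx
    by_contra! hcon
    apply no_line hd hF₂ hs₂ ((LinearIndependent.pair_iff' hq).mpr hcon)
    intro s t
    have := hW.2 _ (W.add_mem (W.smul_mem s hqW) (W.smul_mem t hx))
    simp only [Prod.smul_mk, Prod.mk_add_mk, smul_zero, add_zero, z1] at this
    exact this.symm
  obtain ⟨⟨a, b⟩, habW, hab⟩ : ∃ v ∈ W, v ∉ Submodule.span ℂ {((p, 0) : V3 × V3), (0, q)} := by
    by_contra! hcon
    have h1 : W ≤ Submodule.span ℂ {((p, 0) : V3 × V3), (0, q)} := hcon
    have h2 := Submodule.finrank_mono h1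
    have h3 : Module.finrank ℂ (Submodule.span ℂ {((p, 0) : V3 × V3), (0, q)}) ≤ 2 := by
      classical
      have := finrank_span_finset_le_card (R := ℂ) ({((p, 0) : V3 × V3), (0, q)} : Finset (V3 × V3))
      have h4 := Finset.card_le_two (a := ((p, 0) : V3 × V3)) (b := (0, q))
      rw [Finset.coe_pair, Set.finrank] at this
      omega
    rw [hW.1] at h2
    omega
  rw [Submodule.mem_span_pair] at hab
  have hpa : LinearIndependent ℂ ![p, a] := by
    rw [LinearIndependent.pair_iff' hp]
    rintro k rfl
    have := W.sub_mem habW (W.smul_mem k hpW)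
    simp at this
    obtain ⟨l, rfl⟩ := hU _ this
    exact hab ⟨k, l, by simp⟩
  have hqb : LinearIndependent ℂ ![q, b] := by
    rw [LinearIndependent.pair_iff' hq]
    rintro k rfl
    have := W.sub_mem habW (W.smul_mem k hqW)
    simp at this
    obtain ⟨l, rfl⟩ := hT _ this
    exact hab ⟨l, k, by simp⟩
  have key : ∀ s r t : ℂ, eval (s • p + t • a) F₁ = eval (r • q + t • b) F₂ := by
    intro s r t
    have := hW.2 _ (W.add_mem (W.add_mem (W.smul_mem s hpW) (W.smul_mem r hqW))
      (W.smul_mem t habW))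
    simpa using this
  have e0 : eval a F₁ = eval b F₂ := by simpa using key 0 0 1
  have d1 : FlexDat d F₁ p a (eval a F₁) := by
    refine ⟨hpa, fun s t => ?_⟩
    rw [key s 0 t, zero_smul, zero_add, eval_smul_hom hF₂, e0, mul_comm]
  have d2 : FlexDat d F₂ q b (eval a F₁) := by
    refine ⟨hqb, fun s t => ?_⟩
    rw [← key 0 s t, zero_smul, zero_add, eval_smul_hom hF₁, mul_comm]
  refine ⟨a, b, eval a F₁, ?_, habW, d1, d2⟩
  intro h0
  apply no_line hd hF₁ hs₁ hpa
  intro s t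
  rw [d1.2, h0, zero_mul]

theorem mkPlane_mem {d : ℕ} {F₁ F₂ : MvPolynomial (Fin 3) ℂ} {p a q b : V3}
    (h1 : FlexDat d F₁ p a 1) (h2 : FlexDat d F₂ q b 1) {z : ℂ} (hz : z ^ d = 1) :
    mkPlane p a q (z • b) ∈ planesP F₁ F₂ := by
  refine ⟨finrank_mkPlane h1.1 (h2.1.ne_zero 0), ?_⟩
  intro v hv
  obtain ⟨s, r, t, rfl⟩ := mem_mkPlane.mp hv
  simp only [smul_smul]
  rw [h1.2, h2.2, mul_pow, hz, mul_one]

theorem mkPlane_left {p a q b : V3} (h2 : LinearIndependent ℂ ![q, b]) {x : V3}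
    (hx : (x, (0 : V3)) ∈ mkPlane p a q b) : ∃ k : ℂ, k • p = x := by
  obtain ⟨s, r, t, h⟩ := mem_mkPlane.mp hx
  rw [Prod.mk.injEq] at h
  have := LinearIndependent.pair_iff.mp h2 r t h.2.symm
  refine ⟨s, ?_⟩
  rw [h.1, this.2]
  simp

theorem mkPlane_right {p a q b : V3} (h1 : LinearIndependent ℂ ![p, a]) {y : V3}
    (hy : ((0 : V3), y) ∈ mkPlane p a q b) : ∃ k : ℂ, k • q = y := by
  obtain ⟨s, r, t, h⟩ := mem_mkPlane.mp hy
  rw [Prod.mk.injEq] at h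
  have := LinearIndependent.pair_iff.mp h1 s t h.1.symm
  refine ⟨r, ?_⟩
  rw [h.2, this.2]
  simp

theorem li_smul {q b : V3} (h : LinearIndependent ℂ ![q, b]) {z : ℂ} (hz : z ≠ 0) :
    LinearIndependent ℂ ![q, z • b] := by
  rw [LinearIndependent.pair_iff] at h ⊢
  intro s t hst
  rw [smul_smul] at hst
  simpa [hz] using h _ _ hst

theorem rep_eq_of_smul {x y : Projectivization ℂ V3} {k : ℂ} (h : k • x.rep = y.rep) : y = x := by
  rw [← x.mk_rep, ← y.mk_rep, Projectivization.mk_eq_mk_iff']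
  exact ⟨k, h⟩

theorem countP {d : ℕ} (hd : 2 ≤ d) {F₁ F₂ : MvPolynomial (Fin 3) ℂ}
    (hF₁ : F₁.IsHomogeneous d) (hF₂ : F₂.IsHomogeneous d) (hs₁ : SmoothF F₁) (hs₂ : SmoothF F₂)
    (hnequiv : ¬ ∃ g : Matrix (Fin 3) (Fin 3) ℂ, IsUnit g.det ∧ applyMat g F₁ = F₂) :
    (planesP F₁ F₂).ncard = d * flexCount d F₁ * flexCount d F₂ := by
  have : NeZero d := ⟨by omega⟩
  let S₁ := {x : Projectivization ℂ V3 | IsDFlexRep d F₁ x.rep}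
  let S₂ := {x : Projectivization ℂ V3 | IsDFlexRep d F₂ x.rep}
  have ex₁ : ∀ x : S₁, ∃ a, FlexDat d F₁ x.1.rep a 1 := fun x => exists_norm hd _ _ x.2
  have ex₂ : ∀ x : S₂, ∃ a, FlexDat d F₂ x.1.rep a 1 := fun x => exists_norm hd _ _ x.2
  choose a ha using ex₁
  choose b hb using ex₂
  let Φ : (rootsOfUnity d ℂ × S₁) × S₂ → Submodule ℂ (V3 × V3) := fun w =>
    mkPlane w.1.2.1.rep (a w.1.2) w.2.1.rep (((w.1.1 : ℂˣ) : ℂ) • b w.2)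
  have hinj : Function.Injective Φ := by
    rintro ⟨⟨z, x⟩, y⟩ ⟨⟨z', x'⟩, y'⟩ h
    simp only [Φ] at h
    have m1 : (x'.1.rep, (0 : V3)) ∈ mkPlane x.1.rep (a x) y.1.rep (((z : ℂˣ) : ℂ) • b y) := by
      rw [h, mem_mkPlane]
      exact ⟨1, 0, 0, by simp⟩
    have m2 : ((0 : V3), y'.1.rep) ∈ mkPlane x.1.rep (a x) y.1.rep (((z : ℂˣ) : ℂ) • b y) := by
      rw [h, mem_mkPlane]
      exact ⟨0, 1, 0, by simp⟩
    obtain ⟨k, hk⟩ := mkPlane_left (li_smul (hb y).1 (Units.ne_zero _)) m1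
    obtain ⟨l, hl⟩ := mkPlane_right (ha x).1 m2
    have ex : x' = x := Subtype.ext (rep_eq_of_smul hk)
    have ey : y' = y := Subtype.ext (rep_eq_of_smul hl)
    subst ex ey
    have m3 : (a x', ((z' : ℂˣ) : ℂ) • b y') ∈
        mkPlane x'.1.rep (a x') y'.1.rep (((z : ℂˣ) : ℂ) • b y') := by
      rw [h, mem_mkPlane]
      exact ⟨0, 0, 1, by simp⟩
    obtain ⟨s, r, t, h3⟩ := mem_mkPlane.mp m3
    rw [Prod.mk.injEq] at h3
    have i1 := LinearIndependent.pair_iff.mp (ha x').1 s (t - 1) (by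
      have := sub_eq_zero.mpr h3.1.symm
      rw [← this]; module)
    have ht : t = 1 := by linear_combination i1.2
    have i2 := LinearIndependent.pair_iff.mp (hb y').1 r (t * ((z : ℂˣ) : ℂ) - ((z' : ℂˣ) : ℂ)) (by
      have := sub_eq_zero.mpr h3.2.symm
      rw [← this]; module)
    have hz : z = z' := by
      apply Subtype.ext
      apply Units.ext
      have := i2.2
      rw [ht] at this
      linear_combination this
    rw [hz]
  have hrange : planesP F₁ F₂ = Set.range Φ := by
    apply Set.Subset.antisymm
    · intro W hW
      obtain ⟨q0, hq0W, hq0⟩ : ∃ y, ((0 : V3), y) ∈ W ∧ y ≠ 0 := by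
        by_contra! hcon
        obtain ⟨A, hA⟩ := graph_case hd hF₁ hF₂ hs₁ hW hcon
        exact hnequiv (equiv_of_eval A.symm fun x => by rw [hA]; simp)
      obtain ⟨p0, hp0W, hp0⟩ : ∃ x, (x, (0 : V3)) ∈ W ∧ x ≠ 0 := by
        by_contra! hcon
        obtain ⟨A, hA⟩ := graph_case hd hF₂ hF₁ hs₂ (planesP_swap hW) (by
          rintro y ⟨⟨u, v⟩, huv, he⟩
          simp at he
          obtain ⟨rfl, rfl⟩ := he
          exact hcon _ huv)
        exact hnequiv (equiv_of_eval A hA)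
      let x := Projectivization.mk ℂ p0 hp0
      let y := Projectivization.mk ℂ q0 hq0
      have hpW : (x.rep, (0 : V3)) ∈ W := by
        obtain ⟨k, hk⟩ := Projectivization.exists_smul_eq_mk_rep ℂ p0 hp0
        have := W.smul_mem (k : ℂ) hp0W
        rw [Prod.smul_mk, smul_zero] at this
        rw [← hk]
        exact this
      have hqW : ((0 : V3), y.rep) ∈ W := by
        obtain ⟨k, hk⟩ := Projectivization.exists_smul_eq_mk_rep ℂ q0 hq0
        have := W.smul_mem (k : ℂ) hq0W
        rw [Prod.smul_mk, smul_zero] at this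
        rw [← hk]
        exact this
      obtain ⟨u, v, c, hc, huv, d1, d2⟩ := plane_struct hd hF₁ hF₂ hs₁ hs₂ hW x.rep_nonzero
        y.rep_nonzero hpW hqW
      let x' : S₁ := ⟨x, (isDFlexRep_iff hd _ _).mpr ⟨u, c, hc, d1⟩⟩
      let y' : S₂ := ⟨y, (isDFlexRep_iff hd _ _).mpr ⟨v, c, hc, d2⟩⟩
      obtain ⟨α, β, hβ, hu⟩ := tangent_unique hd hs₁ (ha x') d1
      obtain ⟨γ, δ, hδ, hv⟩ := tangent_unique hd hs₂ (hb y') d2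
      have e1 : β ^ d = c := by
        have h1 := (ha x').2 α β
        have h2 := d1.2 0 1
        rw [← hu] at h1
        simp only [zero_smul, one_smul, zero_add, one_pow, mul_one, one_mul] at h1 h2
        rw [← h1, ← h2]
      have e2 : δ ^ d = c := by
        have h1 := (hb y').2 γ δ
        have h2 := d2.2 0 1
        rw [← hv] at h1
        simp only [zero_smul, one_smul, zero_add, one_pow, mul_one, one_mul] at h1 h2
        rw [← h1, ← h2]
      have hz : (δ / β) ^ d = 1 := by rw [div_pow, e1, e2, div_self hc]
      let z : rootsOfUnity d ℂ := rootsOfUnity.mkOfPowEq (δ / β) hz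
      have hzc : ((z : ℂˣ) : ℂ) = δ / β := rootsOfUnity.coe_mkOfPowEq hz
      refine ⟨((z, x'), y'), ?_⟩
      have hmem : (a x', ((z : ℂˣ) : ℂ) • b y') ∈ W := by
        have := W.smul_mem β⁻¹ (W.sub_mem (W.sub_mem huv (W.smul_mem α hpW)) (W.smul_mem γ hqW))
        convert this using 1
        rw [hu, hv, hzc]
        ext i
        · simp [x']
          field_simp
          try ring
        · simp [y']
          field_simp
          try ring
      apply Submodule.eq_of_le_of_finrank_eq
      · intro w hw
        obtain ⟨s, r, t, rfl⟩ := mem_mkPlane.mp hw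
        have := W.add_mem (W.add_mem (W.smul_mem s hpW) (W.smul_mem r hqW)) (W.smul_mem t hmem)
        simpa [x', y'] using this
      · rw [hW.1]
        exact finrank_mkPlane (ha x').1 (y.rep_nonzero)
    · rintro _ ⟨⟨⟨z, x⟩, y⟩, rfl⟩
      apply mkPlane_mem (ha x) (hb y)
      have := (mem_rootsOfUnity' d (z : ℂˣ)).mp z.2
      exact this
  rw [hrange, ← Nat.card_coe_set_eq, Nat.card_range_of_injective hinj, Nat.card_prod, Nat.card_prod,
    Complex.card_rootsOfUnity]
  rfl

/-- splitting of coordinates -/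
def splitMap : (Fin 6 → ℂ) →ₗ[ℂ] V3 × V3 :=
  (LinearMap.funLeft ℂ ℂ (![0, 1, 2] : Fin 3 → Fin 6)).prod
    (LinearMap.funLeft ℂ ℂ (![3, 4, 5] : Fin 3 → Fin 6))

theorem splitMap_inj : Function.Injective splitMap := by
  intro u v h
  have h1 := congrFun (congrArg Prod.fst h)
  have h2 := congrFun (congrArg Prod.snd h)
  funext i
  fin_cases i
  · exact h1 0
  · exact h1 1
  · exact h1 2
  · exact h2 0
  · exact h2 1
  · exact h2 2

def splitEquiv : (Fin 6 → ℂ) ≃ₗ[ℂ] V3 × V3 :=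
  LinearMap.linearEquivOfInjective splitMap splitMap_inj (by simp)

theorem eval_hyper (F₁ F₂ : MvPolynomial (Fin 3) ℂ) (v : Fin 6 → ℂ) :
    eval v (hyperPoly F₁ F₂) = eval (splitEquiv v).1 F₁ - eval (splitEquiv v).2 F₂ := by
  rw [hyperPoly, map_sub, eval_rename, eval_rename]
  rfl

theorem planes_ncard (F₁ F₂ : MvPolynomial (Fin 3) ℂ) :
    (planesIn (hyperPoly F₁ F₂)).ncard = (planesP F₁ F₂).ncard := by
  have hinj : Function.Injective (Submodule.map (splitEquiv : (Fin 6 → ℂ) →ₗ[ℂ] V3 × V3)) :=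
    Submodule.map_injective_of_injective splitEquiv.injective
  rw [← Set.ncard_image_of_injective _ hinj]
  congr 1
  apply Set.Subset.antisymm
  · rintro _ ⟨W, hW, rfl⟩
    refine ⟨?_, ?_⟩
    · rw [LinearEquiv.finrank_map_eq]; exact hW.1
    · rintro _ ⟨v, hv, rfl⟩
      have := hW.2 v hv
      rw [eval_hyper, sub_eq_zero] at this
      exact this
  · intro W hW
    refine ⟨W.map (splitEquiv.symm : V3 × V3 →ₗ[ℂ] (Fin 6 → ℂ)), ⟨?_, ?_⟩, ?_⟩
    · rw [LinearEquiv.finrank_map_eq]; exact hW.1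
    · rintro _ ⟨v, hv, rfl⟩
      rw [eval_hyper, sub_eq_zero]
      simpa using hW.2 v hv
    · rw [← Submodule.map_comp]
      simp

theorem grad_hyper (F₁ F₂ : MvPolynomial (Fin 3) ℂ) (v u : Fin 6 → ℂ) :
    gradF (hyperPoly F₁ F₂) v u =
      gradF F₁ (splitEquiv v).1 (splitEquiv u).1 - gradF F₂ (splitEquiv v).2 (splitEquiv u).2 := by
  have h := hasDerivAt_line (hyperPoly F₁ F₂) v u
  simp only [eval_hyper, map_add, map_smul, Prod.fst_add, Prod.snd_add, Prod.smul_fst,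
    Prod.smul_snd] at h
  exact h.unique ((hasDerivAt_line F₁ _ _).sub (hasDerivAt_line F₂ _ _))

theorem smooth_of_hyper {d : ℕ} (hd : 2 ≤ d) {F₁ F₂ : MvPolynomial (Fin 3) ℂ}
    (hF₁ : F₁.IsHomogeneous d) (hF₂ : F₂.IsHomogeneous d)
    (hsmooth : ∀ v : Fin 6 → ℂ, v ≠ 0 →
      ¬ (eval v (hyperPoly F₁ F₂) = 0 ∧ ∀ i, eval v (pderiv i (hyperPoly F₁ F₂)) = 0))
    (w : V3 × V3) (hw : w ≠ 0) (h1 : gradF F₁ w.1 = 0) (h2 : gradF F₂ w.2 = 0) : False := by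
  apply hsmooth (splitEquiv.symm w) (by simpa using hw)
  rw [← gradF_eq_zero_iff]
  refine ⟨?_, ?_⟩
  · rw [eval_hyper, LinearEquiv.apply_symm_apply, euler_zero hd hF₁ _ h1, euler_zero hd hF₂ _ h2,
      sub_zero]
  · apply LinearMap.ext
    intro u
    rw [grad_hyper, LinearEquiv.apply_symm_apply, h1, h2]
    simp

/-- Let `X ⊂ ℙ⁵` be a smooth hypersurface of degree `d ≥ 3` defined by
`F₁(x₀,x₁,x₂) = F₂(y₀,y₁,y₂)` with `F₁` not equivalent to `F₂` under `GL₃(ℂ)`. Then `X`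
contains exactly `d·ν₁·ν₂` planes, where `νᵢ` is the number of `d`-flex points of `Fᵢ = 0`. -/
theorem stmt_12 (d : ℕ) (hd : 3 ≤ d) (F₁ F₂ : MvPolynomial (Fin 3) ℂ)
    (hF₁ : F₁.IsHomogeneous d) (hF₂ : F₂.IsHomogeneous d)
    (hsmooth : ∀ v : Fin 6 → ℂ, v ≠ 0 →
      ¬ (eval v (hyperPoly F₁ F₂) = 0 ∧ ∀ i, eval v (pderiv i (hyperPoly F₁ F₂)) = 0))
    (hnequiv : ¬ ∃ g : Matrix (Fin 3) (Fin 3) ℂ, IsUnit g.det ∧ applyMat g F₁ = F₂) :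
    (planesIn (hyperPoly F₁ F₂)).ncard = d * flexCount d F₁ * flexCount d F₂ := by
  have hd2 : 2 ≤ d := by omega
  have hs₁ : SmoothF F₁ := fun v hv h =>
    smooth_of_hyper hd2 hF₁ hF₂ hsmooth (v, 0) (by simpa using hv) h (gradF_zero hd2 hF₂)
  have hs₂ : SmoothF F₂ := fun v hv h =>
    smooth_of_hyper hd2 hF₁ hF₂ hsmooth (0, v) (by simpa using hv) (gradF_zero hd2 hF₁) h
  rw [planes_ncard]
  exact countP hd2 hF₁ hF₂ hs₁ hs₂ hnequiv

end
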